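/- Let n ≥ 2, K ∈ 𝒦ⁿ a convex body, and θ ∈ S^{n-1}. Let a = min{⟨x,θ⟩ : x ∈ K} and b = max{⟨x,θ⟩ : x ∈ K}, and define f_θ(s) = vol_{n-1}(K ∩ T_{θ,s})^{1/(n-1)}. Suppose f_θ is continuous on ℝ and attains its maximum at a unique point. Let S be uniformly distributed on [a,b]. Then the cumulative distribution function z ↦ P(f_θ(S) ≤ z) is convex, continuous and strictly increasing on the interval [0, m_K(θ)^{1/(n-1)}], where m_K(θ) = max_{s∈ℝ} vol_{n-1}(K ∩ T_{θ,s}); in particular this conditional CDF is absolutely continuous with respect to Lebesgue measure. -/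

import Mathlib

open MeasureTheory Set Pointwise
open scoped RealInnerProductSpace NNReal ENNReal

noncomputable section

abbrev Euc (n : ℕ) := EuclideanSpace ℝ (Fin n)

/-- The unit sphere `S^{n-1}` in `ℝⁿ`. -/
def unitSphere (n : ℕ) : Set (Euc n) := {θ | ‖θ‖ = 1}

/-- The upper hemisphere `S₊^{n-1}`: unit vectors whose last coordinate is nonnegative. -/
def upperHemi (n : ℕ) : Set (Euc n) :=
  {θ | ‖θ‖ = 1 ∧ ∀ i : Fin n, (i : ℕ) = n - 1 → 0 ≤ θ i}

/-- The hyperplane `T_{θ,s} = {x : ⟨x,θ⟩ = s}`. -/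
def hyperplane {n : ℕ} (θ : Euc n) (s : ℝ) : Set (Euc n) := {x | ⟪x, θ⟫ = s}

/-- Spherical Lebesgue measure, realized as the `(n-1)`-dimensional Hausdorff measure. -/
def sphMeasure (n : ℕ) : Measure (Euc n) := μH[(n : ℝ) - 1]

/-- `vol_{n-1}(K ∩ T_{θ,s})`. -/
def sectionVolume {n : ℕ} (K : Set (Euc n)) (θ : Euc n) (s : ℝ) : ℝ :=
  (μH[(n : ℝ) - 1] (K ∩ hyperplane θ s)).toReal

/-- `μ([K])`. -/
def muBracket {n : ℕ} (K : Set (Euc n)) : ℝ :=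
  ∫ θ in upperHemi n,
    (∫ s : ℝ, Set.indicator {s : ℝ | (K ∩ hyperplane θ s).Nonempty} (fun _ => (1 : ℝ)) s)
    ∂ sphMeasure n

/-- The section volume CDF `G_K`. -/
def sectionCDF {n : ℕ} (K : Set (Euc n)) (z : ℝ) : ℝ :=
  (1 / muBracket K) *
    ∫ θ in upperHemi n,
      (∫ s : ℝ, Set.indicator
          {s : ℝ | sectionVolume K θ s ≤ z ∧ (K ∩ hyperplane θ s).Nonempty}
          (fun _ => (1 : ℝ)) s)
      ∂ sphMeasure n

/-- A convex body: a compact convex set with nonempty interior. -/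
structure IsConvexBody {n : ℕ} (K : Set (Euc n)) : Prop where
  convex : Convex ℝ K
  isCompact : IsCompact K
  interiorNonempty : (interior K).Nonempty


/-- `f_θ(s) = vol_{n-1}(K ∩ T_{θ,s})^{1/(n-1)}`. -/
def fTheta {n : ℕ} (K : Set (Euc n)) (θ : Euc n) (s : ℝ) : ℝ :=
  sectionVolume K θ s ^ ((1 : ℝ) / ((n : ℝ) - 1))

/-- The inner section function `m_K(θ) = max_s vol_{n-1}(K ∩ T_{θ,s})`. -/
def innerSection {n : ℕ} (K : Set (Euc n)) (θ : Euc n) : ℝ :=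
  ⨆ s : ℝ, sectionVolume K θ s

/-- A CDF `G` is absolutely continuous w.r.t. Lebesgue measure if it admits a Lebesgue
density, i.e. `G z = ∫_{-∞}^z g(t) dt` for some nonnegative `g`. -/
def IsAbsolutelyContinuousCDF (G : ℝ → ℝ) : Prop :=
  ∃ g : ℝ → ℝ, (∀ t, 0 ≤ g t) ∧ ∀ z : ℝ, G z = ∫ t in Set.Iic z, g t

/-- The width of `K` in direction `θ`: the length of the orthogonal projection of `K` on the
line through the origin with direction `θ`. -/
def width {n : ℕ} (K : Set (Euc n)) (θ : Euc n) : ℝ :=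
  sSup ((fun x => ⟪x, θ⟫) '' K) - sInf ((fun x => ⟪x, θ⟫) '' K)

/-- The mean width `b̄(K)`. -/
def meanWidth {n : ℕ} (K : Set (Euc n)) : ℝ :=
  (1 / (sphMeasure n (upperHemi n)).toReal) * ∫ θ in upperHemi n, width K θ ∂ sphMeasure n

/-- A strictly convex body: a convex body such that every proper convex combination of two
distinct points of `K` lies in the interior of `K`. -/
def IsStrictlyConvexBody {n : ℕ} (K : Set (Euc n)) : Prop :=
  IsConvexBody K ∧ ∀ x ∈ K, ∀ y ∈ K, x ≠ y →
    ∀ l : ℝ, l ∈ Set.Ioo (0 : ℝ) 1 → l • x + (1 - l) • y ∈ interior K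

/-- A full-dimensional convex polytope: the convex hull of finitely many points, with
nonempty interior. -/
def IsFullDimPolytope {n : ℕ} (P : Set (Euc n)) : Prop :=
  (∃ V : Finset (Euc n), P = convexHull ℝ (V : Set (Euc n))) ∧ (interior P).Nonempty

lemma bm1_compact (A B C : Set ℝ) (hA : IsCompact A) (hB : IsCompact B) (hA0 : A.Nonempty)
    (hB0 : B.Nonempty) (h : ∀ x ∈ A, ∀ y ∈ B, x + y ∈ C) :
    volume A + volume B ≤ volume C := by
  obtain ⟨a, ha, ha'⟩ := hA.exists_isGreatest hA0
  obtain ⟨b, hb, hb'⟩ := hB.exists_isLeast hB0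
  have e1 : volume ((fun x => x + b) '' A) = volume A := by
    rw [Set.image_add_right, measure_preimage_add_right]
  have e2 : volume ((fun x => a + x) '' B) = volume B := by
    rw [Set.image_add_left, measure_preimage_add]
  rw [← e1, ← e2, ← measure_union₀]
  · apply measure_mono
    rintro _ (⟨x, hx, rfl⟩ | ⟨y, hy, rfl⟩)
    · exact h x hx b hb
    · exact h a ha y hy
  · exact (hB.image (by fun_prop)).measurableSet.nullMeasurableSet
  · refine measure_mono_null (t := {a + b}) ?_ (by simp)
    rintro _ ⟨⟨x, hx, rfl⟩, ⟨y, hy, hxy⟩⟩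
    have h1 := hb' hy
    have h2 := ha' hx
    simp only [Set.mem_singleton_iff] at *
    linarith

lemma bm1 (A B C : Set ℝ) (hA : MeasurableSet A) (hB : MeasurableSet B) (hA0 : A.Nonempty)
    (hB0 : B.Nonempty) (h : ∀ x ∈ A, ∀ y ∈ B, x + y ∈ C) :
    volume A + volume B ≤ volume C := by
  by_contra hc
  push Not at hc
  obtain ⟨a, ha⟩ := hA0
  obtain ⟨b, hb⟩ := hB0
  rcases eq_or_ne (volume A) 0 with hA' | hA'
  · rw [hA', zero_add, ← measure_preimage_add volume (-a) B] at hc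
    refine absurd (measure_mono ?_) hc.not_ge
    intro y hy
    simpa using h a ha _ hy
  rcases eq_or_ne (volume B) 0 with hB' | hB'
  · rw [hB', add_zero, ← measure_preimage_add volume (-b) A] at hc
    refine absurd (measure_mono ?_) hc.not_ge
    intro y hy
    simpa using h _ hy b hb
  obtain ⟨u, hu, v, hv, huv⟩ := ENNReal.exists_lt_add_of_lt_add hc hA' hB'
  obtain ⟨K, KA, hK, hKu⟩ := hA.exists_lt_isCompact hu
  obtain ⟨L, LB, hL, hLv⟩ := hB.exists_lt_isCompact hv
  have := bm1_compact K L C hK hL (nonempty_of_measure_ne_zero (ne_bot_of_gt hKu))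
    (nonempty_of_measure_ne_zero (ne_bot_of_gt hLv)) (fun x hx y hy => h x (KA hx) y (LB hy))
  exact absurd (huv.trans (ENNReal.add_lt_add hKu hLv)) this.not_gt

lemma bm1w (A B C : Set ℝ) (hA : MeasurableSet A) (hB : MeasurableSet B) (hA0 : A.Nonempty)
    (hB0 : B.Nonempty) (u v : ℝ) (hu : 0 < u) (hv : 0 < v)
    (h : ∀ x ∈ A, ∀ y ∈ B, u * x + v * y ∈ C) :
    ENNReal.ofReal u * volume A + ENNReal.ofReal v * volume B ≤ volume C := by
  have key : ∀ (w : ℝ), 0 < w → ∀ S : Set ℝ,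
      volume (w • S) = ENNReal.ofReal w * volume S := by
    intro w hw S
    rw [Measure.addHaar_smul]
    simp [abs_of_pos hw]
  rw [← key u hu, ← key v hv]
  apply bm1
  · exact hA.const_smul_of_ne_zero hu.ne'
  · exact hB.const_smul_of_ne_zero hv.ne'
  · exact hA0.smul_set
  · exact hB0.smul_set
  · rintro _ ⟨x, hx, rfl⟩ _ ⟨y, hy, rfl⟩
    exact h x hx y hy

lemma amgm_ennreal (a b : ℝ≥0∞) (t : ℝ) (h0 : 0 < t) (h1 : t < 1) :
    a ^ (1 - t) * b ^ t ≤ ENNReal.ofReal (1 - t) * a + ENNReal.ofReal t * b := by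
  have h1' : 0 < 1 - t := by linarith
  rcases eq_or_ne a ⊤ with rfl | ha
  · rw [ENNReal.mul_top (by simpa using h1)]; simp
  rcases eq_or_ne b ⊤ with rfl | hb
  · rw [ENNReal.mul_top (a := ENNReal.ofReal t) (by simpa using h0)]; simp
  lift a to ℝ≥0 using ha
  lift b to ℝ≥0 using hb
  rw [← ENNReal.coe_rpow_of_nonneg _ h1'.le, ← ENNReal.coe_rpow_of_nonneg _ h0.le]
  simp only [ENNReal.ofReal]
  norm_cast
  have := NNReal.geom_mean_le_arith_mean2_weighted (Real.toNNReal (1-t)) (Real.toNNReal t) a b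
    (by rw [← Real.toNNReal_add h1'.le h0.le]; simp)
  simpa [Real.coe_toNNReal _ h1'.le, Real.coe_toNNReal _ h0.le] using this

lemma layer01 (f : ℝ → ℝ) (hf : Measurable f) (f0 : ∀ x, 0 ≤ f x) (f1 : ∀ x, f x ≤ 1) :
    ∫⁻ x, ENNReal.ofReal (f x) = ∫⁻ r in Ioo (0:ℝ) 1, volume {x | r ≤ f x} := by
  rw [lintegral_eq_lintegral_meas_le _ (Filter.Eventually.of_forall f0) hf.aemeasurable]
  have : ∫⁻ r in Ioi (0:ℝ), volume {x | r ≤ f x} = ∫⁻ r in Ioc (0:ℝ) 1, volume {x | r ≤ f x} := by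
    rw [← Ioc_union_Ioi_eq_Ioi (zero_le_one' ℝ), lintegral_union measurableSet_Ioi]
    · rw [setLIntegral_congr_fun (g := fun _ => 0) measurableSet_Ioi]
      · simp
      · intro r hr
        have : {x | r ≤ f x} = ∅ := by
          ext x
          simp only [mem_ofPred_eq, mem_empty_iff_false, iff_false, not_le]
          exact (f1 x).trans_lt hr
        simp [this]
    · exact Ioc_disjoint_Ioi le_rfl
  rw [this]
  exact setLIntegral_congr Ioo_ae_eq_Ioc.symm

lemma pl1_norm (f g h : ℝ → ℝ) (hf : Measurable f) (hg : Measurable g) (hh : Measurable h)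
    (f0 : ∀ x, 0 ≤ f x) (g0 : ∀ x, 0 ≤ g x) (h0 : ∀ x, 0 ≤ h x)
    (f1 : ∀ x, f x ≤ 1) (g1 : ∀ x, g x ≤ 1)
    (fs : ∀ r < 1, ∃ x, r ≤ f x) (gs : ∀ r < 1, ∃ x, r ≤ g x)
    (t : ℝ) (t0 : 0 < t) (t1 : t < 1)
    (H : ∀ x y, f x ^ (1 - t) * g y ^ t ≤ h ((1 - t) * x + t * y)) :
    (∫⁻ x, ENNReal.ofReal (f x)) ^ (1 - t) * (∫⁻ x, ENNReal.ofReal (g x)) ^ t ≤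
      ∫⁻ x, ENNReal.ofReal (h x) := by
  refine (amgm_ennreal _ _ t t0 t1).trans ?_
  have mm : ∀ f : ℝ → ℝ, Measurable fun r : ℝ => volume {x | r ≤ f x} := fun f =>
    Antitone.measurable fun r s hrs => measure_mono fun x hx => hrs.trans hx
  rw [layer01 f hf f0 f1, layer01 g hg g0 g1,
    lintegral_eq_lintegral_meas_le _ (Filter.Eventually.of_forall h0) hh.aemeasurable,
    ← lintegral_const_mul _ (mm f), ← lintegral_const_mul _ (mm g),
    ← lintegral_add_left ((mm f).const_mul _)]
  refine le_trans ?_ (lintegral_mono_set (s := Ioo (0:ℝ) 1) Ioo_subset_Ioi_self)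
  refine setLIntegral_mono' measurableSet_Ioo fun r hr => ?_
  refine bm1w _ _ _ (measurableSet_le measurable_const hf) (measurableSet_le measurable_const hg)
    (fs r hr.2) (gs r hr.2) _ _ (by linarith) t0 ?_
  intro x hx y hy
  simp only [mem_ofPred_eq] at *
  refine le_trans ?_ (H x y)
  calc r = r ^ (1 - t) * r ^ t := by rw [← Real.rpow_add hr.1]; simp
    _ ≤ _ := by
      have := hr.1.le
      have : 0 ≤ 1 - t := by linarith
      gcongr
      exact Real.rpow_nonneg (f0 x) _

lemma pl1 (f g h : ℝ → ℝ) (hf : Measurable f) (hg : Measurable g) (hh : Measurable h)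
    (f0 : ∀ x, 0 ≤ f x) (g0 : ∀ x, 0 ≤ g x) (h0 : ∀ x, 0 ≤ h x)
    (fb : BddAbove (range f)) (gb : BddAbove (range g))
    (t : ℝ) (t0 : 0 < t) (t1 : t < 1)
    (H : ∀ x y, f x ^ (1 - t) * g y ^ t ≤ h ((1 - t) * x + t * y)) :
    (∫⁻ x, ENNReal.ofReal (f x)) ^ (1 - t) * (∫⁻ x, ENNReal.ofReal (g x)) ^ t ≤
      ∫⁻ x, ENNReal.ofReal (h x) := by
  have t1' : 0 < 1 - t := by linarith
  have aux : ∀ f : ℝ → ℝ, (∀ x, 0 ≤ f x) → BddAbove (range f) →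
      (∫⁻ x, ENNReal.ofReal (f x) = 0) ∨ ∃ P, 0 < P ∧ (∀ x, f x / P ≤ 1) ∧
        ∀ r < 1, ∃ x, r ≤ f x / P := by
    intro f f0 fb
    rcases (Real.iSup_nonneg f0).eq_or_lt with h | h
    · left
      have : ∀ x, f x = 0 := fun x => le_antisymm (h ▸ le_ciSup fb x) (f0 x)
      simp [this]
    · right
      refine ⟨_, h, fun x => (div_le_one h).2 (le_ciSup fb x), fun r hr => ?_⟩
      obtain ⟨x, hx⟩ := exists_lt_of_lt_ciSup (show r * (⨆ x, f x) < ⨆ x, f x by nlinarith)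
      exact ⟨x, (le_div_iff₀ h).2 hx.le⟩
  rcases aux f f0 fb with hf0 | ⟨P, P0, fP, fP'⟩
  · simp [hf0, t1']
  rcases aux g g0 gb with hg0 | ⟨Q, Q0, gQ, gQ'⟩
  · simp [hg0, t0]
  have R0 : 0 < P ^ (1 - t) * Q ^ t := by positivity
  have := pl1_norm (fun x => f x / P) (fun x => g x / Q) (fun x => h x / (P ^ (1 - t) * Q ^ t))
    (hf.div_const _) (hg.div_const _) (hh.div_const _) (fun x => div_nonneg (f0 x) P0.le)
    (fun x => div_nonneg (g0 x) Q0.le) (fun x => div_nonneg (h0 x) R0.le) fP gQ fP' gQ' t t0 t1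
    (fun x y => by
      rw [Real.div_rpow (f0 x) P0.le, Real.div_rpow (g0 y) Q0.le, div_mul_div_comm]
      exact div_le_div_of_nonneg_right (H x y) R0.le)
  have sc : ∀ (f : ℝ → ℝ) (hf : Measurable f) (P : ℝ), 0 < P → ∫⁻ x, ENNReal.ofReal (f x) =
      ENNReal.ofReal P * ∫⁻ x, ENNReal.ofReal (f x / P) := by
    intro f hf P hP
    rw [← lintegral_const_mul _ (hf.div_const _).ennreal_ofReal]
    congr with x
    rw [← ENNReal.ofReal_mul hP.le, mul_div_cancel₀ _ hP.ne']
  rw [sc f hf P P0, sc g hg Q Q0, sc h hh _ R0, ENNReal.mul_rpow_of_nonneg _ _ t1'.le,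
    ENNReal.mul_rpow_of_nonneg _ _ t0.le, mul_mul_mul_comm]
  refine mul_le_mul' (le_of_eq ?_) this
  rw [ENNReal.ofReal_mul (by positivity), ENNReal.ofReal_rpow_of_pos P0,
    ENNReal.ofReal_rpow_of_pos Q0]

def sec {d : ℕ} (A : Set (Fin (d + 1) → ℝ)) (x : ℝ) : Set (Fin d → ℝ) :=
  {y | (Fin.cons x y : Fin (d + 1) → ℝ) ∈ A}

lemma sec_subset {d : ℕ} (A : Set (Fin (d + 1) → ℝ)) (x : ℝ) : sec A x ⊆ Fin.tail '' A := by
  intro y hy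
  exact ⟨_, hy, by simp⟩

lemma continuous_tail {d : ℕ} : Continuous (Fin.tail : (Fin (d + 1) → ℝ) → (Fin d → ℝ)) := by
  unfold Fin.tail
  fun_prop

lemma continuous_consf {d : ℕ} :
    Continuous (fun p : ℝ × (Fin d → ℝ) => (Fin.cons p.1 p.2 : Fin (d + 1) → ℝ)) := by
  refine continuous_pi fun i => ?_
  refine Fin.cases ?_ (fun j => ?_) i
  · simpa using continuous_fst
  · simp only [Fin.cons_succ]; fun_prop

lemma isCompact_sec {d : ℕ} (A : Set (Fin (d + 1) → ℝ)) (hA : IsCompact A) (x : ℝ) :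
    IsCompact (sec A x) := by
  refine IsCompact.of_isClosed_subset (hA.image continuous_tail) ?_ (sec_subset A x)
  exact hA.isClosed.preimage (continuous_consf.comp (by fun_prop : Continuous fun y => (x, y)))

lemma volume_eq_sec {d : ℕ} (A : Set (Fin (d + 1) → ℝ)) (hA : MeasurableSet A) :
    volume A = ∫⁻ x, volume (sec A x) ∧ Measurable fun x => volume (sec A x) := by
  have hm : MeasurableSet ((fun p : ℝ × (Fin d → ℝ) => (Fin.cons p.1 p.2 : Fin (d + 1) → ℝ)) ⁻¹' A) :=
    continuous_consf.measurable hA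
  constructor
  · have := (volume_preserving_piFinSuccAbove (fun _ : Fin (d + 1) => ℝ) 0).symm.measure_preimage
      hA.nullMeasurableSet
    rw [← this]
    have e : ((MeasurableEquiv.piFinSuccAbove (fun _ : Fin (d + 1) => ℝ) 0).symm) ⁻¹' A =
      ((fun p : ℝ × (Fin d → ℝ) => (Fin.cons p.1 p.2 : Fin (d + 1) → ℝ)) ⁻¹' A) := by
      ext p
      simp [MeasurableEquiv.piFinSuccAbove, Fin.insertNthEquiv]
    rw [e, Measure.volume_eq_prod, Measure.prod_apply hm]
    rfl
  · exact measurable_measure_prodMk_left hm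

lemma bm_mul (t : ℝ) (t0 : 0 < t) (t1 : t < 1) : ∀ (d : ℕ) (A B C : Set (Fin d → ℝ)),
    IsCompact A → IsCompact B → IsCompact C →
    (∀ x ∈ A, ∀ y ∈ B, (1 - t) • x + t • y ∈ C) →
    volume A ^ (1 - t) * volume B ^ t ≤ volume C := by
  have t1' : 0 < 1 - t := by linarith
  intro d
  induction d with
  | zero =>
    intro A B C _ _ _ H
    rcases A.eq_empty_or_nonempty with rfl | ⟨x, hx⟩
    · simp [t1']
    rcases B.eq_empty_or_nonempty with rfl | ⟨y, hy⟩
    · simp [t0]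
    have hAu : A = univ := Subsingleton.eq_univ_of_nonempty ⟨x, hx⟩
    have hBu : B = univ := Subsingleton.eq_univ_of_nonempty ⟨y, hy⟩
    have hCu : C = univ := Subsingleton.eq_univ_of_nonempty ⟨_, H x hx y hy⟩
    rw [hAu, hBu, hCu]
    simp [volume_pi]
  | succ d ih =>
    intro A B C hA hB hC H
    have fin : ∀ A : Set (Fin (d + 1) → ℝ), IsCompact A → ∀ x,
        ENNReal.ofReal (volume (sec A x)).toReal = volume (sec A x) := fun A hA x =>
      ENNReal.ofReal_toReal (isCompact_sec A hA x).measure_lt_top.ne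
    have bdd : ∀ A : Set (Fin (d + 1) → ℝ), IsCompact A →
        BddAbove (range fun x => (volume (sec A x)).toReal) := by
      intro A hA
      refine ⟨(volume (Fin.tail '' A)).toReal, ?_⟩
      rintro _ ⟨x, rfl⟩
      exact ENNReal.toReal_mono (hA.image continuous_tail).measure_lt_top.ne
        (measure_mono (sec_subset A x))
    have := pl1 (fun x => (volume (sec A x)).toReal) (fun x => (volume (sec B x)).toReal)
      (fun x => (volume (sec C x)).toReal) (volume_eq_sec A hA.measurableSet).2.ennreal_toReal
      (volume_eq_sec B hB.measurableSet).2.ennreal_toReal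
      (volume_eq_sec C hC.measurableSet).2.ennreal_toReal (fun _ => ENNReal.toReal_nonneg)
      (fun _ => ENNReal.toReal_nonneg) (fun _ => ENNReal.toReal_nonneg) (bdd A hA) (bdd B hB)
      t t0 t1 (by
        intro x y
        have := ih (sec A x) (sec B y) (sec C ((1 - t) * x + t * y)) (isCompact_sec A hA x)
          (isCompact_sec B hB y) (isCompact_sec C hC _) (by
            intro u hu v hv
            have := H _ hu _ hv
            simp only [sec, mem_ofPred_eq]
            convert this using 1
            ext i
            refine Fin.cases ?_ (fun j => ?_) i <;> simp)
        rw [ENNReal.toReal_rpow, ENNReal.toReal_rpow, ← ENNReal.toReal_mul]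
        exact ENNReal.toReal_mono (isCompact_sec C hC _).measure_lt_top.ne this)
    simp only [fin A hA, fin B hB, fin C hC] at this
    rwa [← (volume_eq_sec A hA.measurableSet).1, ← (volume_eq_sec B hB.measurableSet).1,
      ← (volume_eq_sec C hC.measurableSet).1] at this

lemma vol_smul {d : ℕ} (w : ℝ) (hw : 0 ≤ w) (S : Set (Fin d → ℝ)) :
    (volume (w • S)).toReal = w ^ d * (volume S).toReal := by
  rw [Measure.addHaar_smul]
  simp
  exact Or.inl (by rw [abs_of_nonneg hw])

lemma bm_point {d : ℕ} (B C : Set (Fin d → ℝ)) (hC : IsCompact C) (p : Fin d → ℝ) (w : ℝ)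
    (hw : 0 ≤ w) (H : ∀ y ∈ B, p + w • y ∈ C) :
    w ^ d * (volume B).toReal ≤ (volume C).toReal := by
  rw [← vol_smul w hw, ← measure_preimage_add volume (-p) (w • B)]
  refine ENNReal.toReal_mono hC.measure_lt_top.ne (measure_mono ?_)
  rintro x ⟨y, hy, hxy⟩
  have := H y hy
  have e : w • y = -p + x := hxy
  rw [e] at this
  simpa using this

lemma bm_add (d : ℕ) (hd : d ≠ 0) (t : ℝ) (t0 : 0 < t) (t1 : t < 1) (A B C : Set (Fin d → ℝ))
    (hA : IsCompact A) (hB : IsCompact B) (hC : IsCompact C) (hA0 : A.Nonempty) (hB0 : B.Nonempty)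
    (H : ∀ x ∈ A, ∀ y ∈ B, (1 - t) • x + t • y ∈ C) :
    (1 - t) * (volume A).toReal ^ ((1:ℝ) / d) + t * (volume B).toReal ^ ((1:ℝ) / d) ≤
      (volume C).toReal ^ ((1:ℝ) / d) := by
  have t1' : 0 < 1 - t := by linarith
  have hd' : (0:ℝ) < d := by positivity
  have root : ∀ w v : ℝ, 0 ≤ w → 0 ≤ v → w ^ d ≤ v → w ≤ v ^ ((1:ℝ) / d) := by
    intro w v hw hv h
    rw [one_div, ← Real.pow_rpow_inv_natCast hw hd]
    exact Real.rpow_le_rpow (by positivity) h (by positivity)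
  have pw : ∀ v : ℝ, 0 ≤ v → (v ^ ((1:ℝ) / d)) ^ d = v := by
    intro v hv
    rw [one_div, Real.rpow_inv_natCast_pow hv hd]
  obtain ⟨p, hp⟩ := hA0
  obtain ⟨q, hq⟩ := hB0
  set α := (volume A).toReal ^ ((1:ℝ) / d) with hα
  set β := (volume B).toReal ^ ((1:ℝ) / d) with hβ
  have α0 : 0 ≤ α := by positivity
  have β0 : 0 ≤ β := by positivity
  have αd : α ^ d = (volume A).toReal := pw _ ENNReal.toReal_nonneg
  have βd : β ^ d = (volume B).toReal := pw _ ENNReal.toReal_nonneg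
  refine root _ _ (by positivity) ENNReal.toReal_nonneg ?_
  rcases α0.eq_or_lt with h | α0
  · rw [← h, mul_zero, zero_add, mul_pow, βd]
    exact bm_point B C hC ((1 - t) • p) t t0.le (fun y hy => H p hp y hy)
  rcases β0.eq_or_lt with h | β0
  · rw [← h, mul_zero, add_zero, mul_pow, αd]
    exact bm_point A C hC (t • q) (1 - t) t1'.le (fun y hy => by rw [add_comm]; exact H y hy q hq)
  set w := (1 - t) * α + t * β with hw
  have w0 : 0 < w := by positivity
  have s0 : 0 < t * β / w := by positivity
  have s1' : 1 - t * β / w = (1 - t) * α / w := by field_simp; rw [hw]; ring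
  have s1 : t * β / w < 1 := by
    have : 0 < (1 - t) * α / w := by positivity
    linarith
  have := bm_mul (t * β / w) s0 s1 d (α⁻¹ • A) (β⁻¹ • B) (w⁻¹ • C) (hA.smul _) (hB.smul _)
    (hC.smul _) (by
      rintro _ ⟨x, hx, rfl⟩ _ ⟨y, hy, rfl⟩
      refine ⟨_, H x hx y hy, ?_⟩
      rw [s1']
      simp only [smul_add, smul_smul]
      congr 2 <;> field_simp)
  have one : ∀ (S : Set (Fin d → ℝ)) (γ : ℝ), 0 < γ → γ ^ d = (volume S).toReal →
      volume (γ⁻¹ • S) = 1 := by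
    intro S γ hγ h
    have := vol_smul γ⁻¹ (by positivity) S
    rw [← h, ← mul_pow, inv_mul_cancel₀ hγ.ne', one_pow] at this
    rwa [ENNReal.toReal_eq_one_iff] at this
  rw [one A α α0 αd, one B β β0 βd] at this
  simp only [ENNReal.one_rpow, one_mul] at this
  have h2 := ENNReal.toReal_mono (hC.smul w⁻¹).measure_lt_top.ne this
  rw [vol_smul _ (by positivity), ENNReal.toReal_one, inv_pow, inv_mul_eq_div,
    le_div_iff₀ (by positivity), one_mul] at h2
  exact h2

lemma section_param (d : ℕ) (θ : Euc (d + 1)) (hθ : ‖θ‖ = 1) :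
    ∃ (ψ : (Fin d → ℝ) →ₗ[ℝ] Euc (d + 1)) (c : ℝ), 0 ≤ c ∧ ∀ K : Set (Euc (d + 1)),
      IsCompact K → ∀ s : ℝ, IsCompact {y | ψ y + s • θ ∈ K} ∧
      sectionVolume K θ s = c * (volume {y | ψ y + s • θ ∈ K}).toReal ∧
      ((K ∩ hyperplane θ s).Nonempty → {y | ψ y + s • θ ∈ K}.Nonempty) := by
  have hθ0 : θ ≠ 0 := by rintro rfl; simp at hθ
  have : Fact (Module.finrank ℝ (Euc (d + 1)) = d + 1) := ⟨by simp⟩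
  let b := OrthonormalBasis.fromOrthogonalSpanSingleton (𝕜 := ℝ) d hθ0
  let φ : EuclideanSpace ℝ (Fin d) →ₗᵢ[ℝ] Euc (d + 1) :=
    (ℝ ∙ θ)ᗮ.subtypeₗᵢ.comp b.repr.symm.toLinearIsometry
  have hφ : ∀ y, ⟪φ y, θ⟫ = 0 := by
    intro y
    have := (b.repr.symm y).2
    rw [Submodule.mem_orthogonal_singleton_iff_inner_left] at this
    exact this
  have hφs : ∀ x : Euc (d + 1), ⟪x, θ⟫ = 0 → ∃ y, φ y = x := by
    intro x hx
    have hx' : x ∈ (ℝ ∙ θ)ᗮ := by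
      rwa [Submodule.mem_orthogonal_singleton_iff_inner_left]
    exact ⟨b.repr ⟨x, hx'⟩, by simp [φ]⟩
  have hθθ : ⟪θ, θ⟫ = 1 := by rw [real_inner_self_eq_norm_sq, hθ]; norm_num
  have : (μH[(d:ℝ)] : Measure (EuclideanSpace ℝ (Fin d))).IsAddHaarMeasure := by
    simpa using isAddHaarMeasure_hausdorffMeasure (E := EuclideanSpace ℝ (Fin d))
  obtain ⟨c, hc⟩ : ∃ c : ℝ≥0, (μH[(d:ℝ)] : Measure (EuclideanSpace ℝ (Fin d))) = c • volume :=
    ⟨_, Measure.isAddLeftInvariant_eq_smul _ _⟩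
  let e := (EuclideanSpace.equiv (Fin d) ℝ)
  refine ⟨φ.toLinearMap ∘ₗ e.symm.toLinearEquiv.toLinearMap, c, c.2, fun K hK s => ?_⟩
  have hiso : Isometry (fun y => φ y + s • θ) := by
    refine Isometry.of_dist_eq fun x y => ?_
    rw [dist_add_right, φ.isometry.dist_eq]
  have hcomp : IsCompact ((fun y => φ y + s • θ) ⁻¹' K) :=
    hiso.isClosedEmbedding.isCompact_preimage hK
  have hset : {y | (φ.toLinearMap ∘ₗ e.symm.toLinearEquiv.toLinearMap) y + s • θ ∈ K} =
      (WithLp.toLp 2) ⁻¹' ((fun y => φ y + s • θ) ⁻¹' K) := rfl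
  rw [hset]
  have him : K ∩ hyperplane θ s = (fun y => φ y + s • θ) '' ((fun y => φ y + s • θ) ⁻¹' K) := by
    rw [image_preimage_eq_inter_range]
    congr 1
    ext x
    simp only [hyperplane, mem_ofPred_eq, mem_range]
    constructor
    · intro hx
      obtain ⟨y, hy⟩ := hφs (x - s • θ) (by rw [inner_sub_left, inner_smul_left, hx, hθθ]; simp)
      exact ⟨y, by rw [hy]; simp⟩
    · rintro ⟨y, rfl⟩
      rw [inner_add_left, inner_smul_left, hφ, hθθ]; simp
  refine ⟨?_, ?_, ?_⟩
  · exact e.toHomeomorph.symm.isClosedEmbedding.isCompact_preimage hcomp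
  · unfold sectionVolume
    rw [him, show (((d + 1 : ℕ) : ℝ) - 1) = d by push_cast; ring,
      hiso.hausdorffMeasure_image (Or.inl (by positivity)), hc,
      (PiLp.volume_preserving_toLp (Fin d)).measure_preimage hcomp.measurableSet.nullMeasurableSet]
    simp
  · rintro hne
    rw [him, image_nonempty] at hne
    obtain ⟨y, hy⟩ := hne
    exact ⟨y.ofLp, hy⟩

lemma fTheta_concave {n : ℕ} (hn : 2 ≤ n)
    (K : Set (Euc n)) (hK : IsConvexBody K) (θ : Euc n) (hθ : ‖θ‖ = 1)
    (a b : ℝ)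
    (ha : IsLeast ((fun x => ⟪x, θ⟫) '' K) a) (hb : IsGreatest ((fun x => ⟪x, θ⟫) '' K) b) :
    ConcaveOn ℝ (Icc a b) (fTheta K θ) := by
  obtain ⟨d, rfl⟩ : ∃ d, n = d + 1 := ⟨n - 1, by omega⟩
  have hd : d ≠ 0 := by omega
  obtain ⟨ψ, c, hc, H⟩ := section_param d θ hθ
  have hf : ∀ s, fTheta K θ s = c ^ ((1:ℝ) / d) *
      (volume {y | ψ y + s • θ ∈ K}).toReal ^ ((1:ℝ) / d) := by
    intro s
    unfold fTheta
    rw [(H K hK.isCompact s).2.1, show (((d + 1 : ℕ) : ℝ) - 1) = d by push_cast; ring,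
      Real.mul_rpow hc ENNReal.toReal_nonneg]
  have hne : ∀ s ∈ Icc a b, (K ∩ hyperplane θ s).Nonempty := by
    have : Convex ℝ ((fun x => ⟪x, θ⟫) '' K) := by
      have := hK.convex.is_linear_image (f := fun x => ⟪x, θ⟫)
        ⟨fun x y => inner_add_left _ _ _, fun c x => by simp [inner_smul_left]⟩
      exact this
    intro s hs
    obtain ⟨x, hx, hxs⟩ := this.ordConnected.out ha.1 hb.1 hs
    exact ⟨x, hx, hxs⟩
  refine concaveOn_iff_forall_pos.2 ⟨convex_Icc a b, ?_⟩
  intro x hx y hy u v hu hv huv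
  obtain rfl : u = 1 - v := by linarith
  simp only [smul_eq_mul]
  rw [hf, hf, hf]
  have := bm_add d hd v hv (by linarith) _ _ _ (H K hK.isCompact x).1 (H K hK.isCompact y).1
    (H K hK.isCompact ((1 - v) * x + v * y)).1 ((H K hK.isCompact x).2.2 (hne x hx))
    ((H K hK.isCompact y).2.2 (hne y hy)) (by
      intro p hp q hq
      have := hK.convex hp hq hu.le hv.le huv
      simp only [mem_ofPred_eq]
      convert this using 1
      simp only [map_add, map_smul, smul_add, add_smul, mul_smul]
      abel)
  have hc' : 0 ≤ c ^ ((1:ℝ) / d) := by positivity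
  nlinarith [mul_le_mul_of_nonneg_left this hc']

lemma level_null (a b c : ℝ) (f : ℝ → ℝ) (hac : a < c) (hcb : c < b)
    (hf : ConcaveOn ℝ (Icc a b) f) (hlt : ∀ s, s ≠ c → f s < f c) (z : ℝ) :
    volume (Icc a b ∩ {s | f s = z}) = 0 := by
  have h1 : ∀ x y, a ≤ x → x < y → y ≤ c → f x < f y := by
    intro x y hx hxy hyc
    have hcx : 0 < c - x := by linarith
    have := hf.2 (show x ∈ Icc a b from ⟨hx, by linarith⟩) (show c ∈ Icc a b from ⟨hac.le, hcb.le⟩)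
      (show 0 ≤ (c - y) / (c - x) from div_nonneg (by linarith) hcx.le)
      (show 0 ≤ (y - x) / (c - x) from div_nonneg (by linarith) hcx.le) (by field_simp; ring)
    simp only [smul_eq_mul] at this
    have e : (c - y) / (c - x) * x + (y - x) / (c - x) * c = y := by field_simp; ring
    rw [e] at this
    have h2 := hlt x (by linarith)
    have h3 : 0 < (y - x) / (c - x) := div_pos (by linarith) hcx
    have h4 : (c - y) / (c - x) = 1 - (y - x) / (c - x) := by field_simp; ring
    rw [h4] at this
    nlinarith
  have h2 : ∀ x y, c ≤ x → x < y → y ≤ b → f y < f x := by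
    intro x y hx hxy hyc
    have hcx : 0 < y - c := by linarith
    have := hf.2 (show y ∈ Icc a b from ⟨by linarith, by linarith⟩) (show c ∈ Icc a b from ⟨hac.le, hcb.le⟩)
      (show 0 ≤ (x - c) / (y - c) from div_nonneg (by linarith) hcx.le)
      (show 0 ≤ (y - x) / (y - c) from div_nonneg (by linarith) hcx.le) (by field_simp; ring)
    simp only [smul_eq_mul] at this
    have e : (x - c) / (y - c) * y + (y - x) / (y - c) * c = x := by field_simp; ring
    rw [e] at this
    have h2 := hlt y (by linarith)
    have h3 : 0 < (y - x) / (y - c) := div_pos (by linarith) hcx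
    have h4 : (x - c) / (y - c) = 1 - (y - x) / (y - c) := by field_simp; ring
    rw [h4] at this
    nlinarith
  have s1 : (Icc a c ∩ {s | f s = z}).Subsingleton := by
    rintro x ⟨hx, hx'⟩ y ⟨hy, hy'⟩
    simp only [mem_ofPred_eq] at hx' hy'
    rcases lt_trichotomy x y with h | h | h
    · have := h1 x y hx.1 h hy.2; linarith
    · exact h
    · have := h1 y x hy.1 h hx.2; linarith
  have s2 : (Icc c b ∩ {s | f s = z}).Subsingleton := by
    rintro x ⟨hx, hx'⟩ y ⟨hy, hy'⟩
    simp only [mem_ofPred_eq] at hx' hy'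
    rcases lt_trichotomy x y with h | h | h
    · have := h2 x y hx.1 h hy.2; linarith
    · exact h
    · have := h2 y x hy.1 h hx.2; linarith
  rw [← Icc_union_Icc_eq_Icc hac.le hcb.le, union_inter_distrib_right]
  exact measure_union_null (s1.measure_zero _) (s2.measure_zero _)

lemma abstract_cdf (a b c : ℝ) (f : ℝ → ℝ) (hac : a < c) (hcb : c < b) (hcont : Continuous f)
    (hf : ConcaveOn ℝ (Icc a b) f) (hlt : ∀ s, s ≠ c → f s < f c) (f0 : ∀ s, 0 ≤ f s)
    (fa : f a = 0) (F : ℝ → ℝ)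
    (hF : ∀ z, F z = (volume (Icc a b ∩ {s : ℝ | f s ≤ z})).toReal / (b - a)) :
    ConvexOn ℝ (Icc 0 (f c)) F ∧ ContinuousOn F (Icc 0 (f c)) ∧
    StrictMonoOn F (Icc 0 (f c)) ∧ IsAbsolutelyContinuousCDF F := by
  have hab : 0 < b - a := by linarith
  have hM : 0 < f c := fa ▸ hlt a hac.ne
  have hle : ∀ s, f s ≤ f c := fun s => by
    rcases eq_or_ne s c with rfl | h
    · exact le_rfl
    · exact (hlt s h).le
  have null := level_null a b c f hac hcb hf hlt
  have fin : ∀ S : Set ℝ, volume (Icc a b ∩ S) ≠ ⊤ := fun S =>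
    measure_ne_top_of_subset inter_subset_left (by simp)
  have mS : ∀ z, MeasurableSet (Icc a b ∩ {s : ℝ | z ≤ f s}) := fun z =>
    measurableSet_Icc.inter (measurableSet_le measurable_const hcont.measurable)
  have mT : ∀ z, MeasurableSet (Icc a b ∩ {s : ℝ | f s ≤ z}) := fun z =>
    measurableSet_Icc.inter (measurableSet_le hcont.measurable measurable_const)
  -- complement formula
  have hW : ∀ z, F z = 1 - (volume (Icc a b ∩ {s : ℝ | z ≤ f s})).toReal / (b - a) := by
    intro z
    have : volume (Icc a b ∩ {s : ℝ | f s ≤ z}) + volume (Icc a b ∩ {s : ℝ | z ≤ f s}) =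
        ENNReal.ofReal (b - a) := by
      rw [← Real.volume_Icc, ← measure_union₀ (mS z).nullMeasurableSet, ← inter_union_distrib_left]
      · congr 1
        ext s
        simp only [mem_inter_iff, mem_union, mem_ofPred_eq, le_total, and_true]
      · refine measure_mono_null ?_ (null z)
        rintro s ⟨⟨h1, h2⟩, ⟨_, h3⟩⟩
        exact ⟨h1, le_antisymm h2 h3⟩
    have := congrArg ENNReal.toReal this
    rw [ENNReal.toReal_add (fin _) (fin _), ENNReal.toReal_ofReal hab.le] at this
    rw [hF]
    field_simp
    linarith
  have hconv : ConvexOn ℝ (Icc 0 (f c)) F := by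
    refine convexOn_iff_forall_pos.2 ⟨convex_Icc _ _, ?_⟩
    intro x hx y hy u v hu hv huv
    have := bm1w (Icc a b ∩ {s : ℝ | x ≤ f s}) (Icc a b ∩ {s : ℝ | y ≤ f s})
      (Icc a b ∩ {s : ℝ | u * x + v * y ≤ f s}) (mS x) (mS y) ⟨c, ⟨hac.le, hcb.le⟩, hx.2⟩
      ⟨c, ⟨hac.le, hcb.le⟩, hy.2⟩ u v hu hv (by
        rintro p ⟨hp, hp'⟩ q ⟨hq, hq'⟩
        refine ⟨convex_Icc a b hp hq hu.le hv.le huv, ?_⟩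
        have := hf.2 hp hq hu.le hv.le huv
        simp only [smul_eq_mul, mem_ofPred_eq] at *
        nlinarith)
    have := ENNReal.toReal_mono (fin _) this
    rw [ENNReal.toReal_add (ENNReal.mul_ne_top (by simp) (fin _))
      (ENNReal.mul_ne_top (by simp) (fin _)), ENNReal.toReal_mul, ENNReal.toReal_mul,
      ENNReal.toReal_ofReal hu.le, ENNReal.toReal_ofReal hv.le] at this
    simp only [smul_eq_mul]
    rw [hW, hW, hW]
    have h2 := div_le_div_of_nonneg_right this hab.le
    rw [add_div, mul_div_assoc, mul_div_assoc] at h2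
    nlinarith
  have hFI : ∀ z, F z = (∫ s in Icc a b, indicator {s | f s ≤ z} (fun _ => (1:ℝ)) s) / (b - a) := by
    intro z
    rw [hF, integral_indicator (measurableSet_le hcont.measurable measurable_const),
      Measure.restrict_restrict (measurableSet_le hcont.measurable measurable_const), inter_comm]
    simp [Measure.real]
  have hFc : Continuous F := by
    rw [funext hFI]
    refine Continuous.div_const (continuous_iff_continuousAt.2 fun z => ?_) _
    refine continuousAt_of_dominated (bound := fun _ => 1) ?_ ?_ ?_ ?_
    · exact Filter.Eventually.of_forall fun z => (measurable_const.indicator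
        (measurableSet_le hcont.measurable measurable_const)).aestronglyMeasurable
    · refine Filter.Eventually.of_forall fun z => Filter.Eventually.of_forall fun s => ?_
      by_cases h : f s ≤ z <;> simp [indicator, h]
    · exact integrable_const _
    · have : ∀ᵐ s ∂(volume.restrict (Icc a b)), f s ≠ z := by
        rw [ae_restrict_iff' measurableSet_Icc, ae_iff]
        refine measure_mono_null ?_ (null z)
        intro s hs
        simp only [ne_eq, mem_ofPred_eq, not_forall, not_not] at hs
        exact ⟨hs.1, hs.2⟩
      filter_upwards [this] with s hs
      rcases lt_or_gt_of_ne hs with h | h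
      · refine (continuousAt_const (y := (1:ℝ))).congr ?_
        filter_upwards [lt_mem_nhds h] with w hw
        simp [indicator, le_of_lt hw]
      · refine (continuousAt_const (y := (0:ℝ))).congr ?_
        filter_upwards [gt_mem_nhds h] with w hw
        simp [indicator, hw]
  have hmono : Monotone F := by
    intro x y hxy
    rw [hF, hF]
    refine div_le_div_of_nonneg_right (ENNReal.toReal_mono (fin _) (measure_mono ?_)) hab.le
    exact inter_subset_inter_right _ fun s hs => le_trans hs hxy
  have hstrict : StrictMonoOn F (Icc 0 (f c)) := by
    intro x hx y hy hxy
    rw [hF, hF]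
    refine div_lt_div_of_pos_right ((ENNReal.toReal_lt_toReal (fin _) (fin _)).2 ?_) hab
    have hop : IsOpen (Ioo a b ∩ {s | x < f s ∧ f s < y}) :=
      isOpen_Ioo.inter ((isOpen_lt continuous_const hcont).inter (isOpen_lt hcont continuous_const))
    have hne : (Ioo a b ∩ {s | x < f s ∧ f s < y}).Nonempty := by
      obtain ⟨s, hs, hs'⟩ := intermediate_value_Icc hac.le hcont.continuousOn
        (show (x + y) / 2 ∈ Icc (f a) (f c) from ⟨by rw [fa]; linarith [hx.1], by linarith [hy.2]⟩)
      refine ⟨s, ⟨lt_of_le_of_ne hs.1 ?_, by linarith [hs.2]⟩, by simp only [mem_ofPred_eq, hs']; constructor <;> linarith⟩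
      rintro rfl
      rw [fa] at hs'
      linarith [hx.1]
    have hpos := hop.measure_pos volume hne
    have hdis : Disjoint (Icc a b ∩ {s : ℝ | f s ≤ x}) (Ioo a b ∩ {s | x < f s ∧ f s < y}) := by
      rw [Set.disjoint_left]
      rintro s ⟨_, h1⟩ ⟨_, h2, _⟩
      exact absurd h1 (not_le.2 h2)
    calc volume (Icc a b ∩ {s : ℝ | f s ≤ x})
        < volume (Icc a b ∩ {s : ℝ | f s ≤ x}) + volume (Ioo a b ∩ {s | x < f s ∧ f s < y}) :=
          ENNReal.lt_add_right (fin _) hpos.ne'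
      _ = volume ((Icc a b ∩ {s : ℝ | f s ≤ x}) ∪ (Ioo a b ∩ {s | x < f s ∧ f s < y})) :=
          (measure_union hdis hop.measurableSet).symm
      _ ≤ _ := by
          refine measure_mono ?_
          rintro s (⟨h1, h2⟩ | ⟨h1, h2, h3⟩)
          · exact ⟨h1, le_trans h2 hxy.le⟩
          · exact ⟨Ioo_subset_Icc_self h1, h3.le⟩
  refine ⟨hconv, hFc.continuousOn, hstrict, ?_⟩
  have F0 : ∀ z ≤ 0, F z = 0 := by
    intro z hz
    have : volume (Icc a b ∩ {s : ℝ | f s ≤ z}) = 0 := by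
      refine measure_mono_null ?_ (null 0)
      rintro s ⟨h1, h2⟩
      exact ⟨h1, le_antisymm (le_trans h2 hz) (f0 s)⟩
    rw [hF, this]; simp
  have F1 : ∀ z, f c ≤ z → F z = F (f c) := by
    intro z hz
    rw [hF, hF]
    have : ∀ w, f c ≤ w → {s | f s ≤ w} = univ := fun w hw =>
      eq_univ_of_forall fun s => (hle s).trans hw
    rw [this z hz, this (f c) le_rfl]
  let g : ℝ → ℝ := fun t => derivWithin F (Ioi t) t
  have g0 : ∀ t, 0 ≤ g t := fun t => (hmono.monotoneOn _).derivWithin_nonneg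
  have hd : ∀ x ∈ Ioo 0 (f c), HasDerivWithinAt F (g x) (Ioi x) x := fun x hx =>
    hconv.hasDerivWithinAt_rightDeriv_of_mem_interior (by rwa [interior_Icc])
  have hint : ∀ z ∈ Icc 0 (f c), ∫ t in Ioc 0 z, g t = F z := by
    intro z hz
    have hd' : ∀ x ∈ Ioo 0 z, HasDerivWithinAt F (g x) (Ioi x) x := fun x hx =>
      hd x ⟨hx.1, hx.2.trans_le hz.2⟩
    have hi := intervalIntegral.integrableOn_deriv_right_of_nonneg hFc.continuousOn hd'
      (fun x _ => g0 x)
    have := intervalIntegral.integral_eq_sub_of_hasDeriv_right_of_le hz.1 hFc.continuousOn hd'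
      ((intervalIntegrable_iff_integrableOn_Ioc_of_le hz.1).2 hi)
    rw [intervalIntegral.integral_of_le hz.1] at this
    rw [this, F0 0 le_rfl, sub_zero]
  refine ⟨indicator (Ioc 0 (f c)) g, fun t => indicator_nonneg (fun t _ => g0 t) t, fun z => ?_⟩
  rw [setIntegral_indicator measurableSet_Ioc]
  have e : Iic z ∩ Ioc 0 (f c) = Ioc 0 (min (f c) z) := by
    ext t; simp only [mem_inter_iff, mem_Iic, mem_Ioc, le_min_iff]; tauto
  rw [e]
  rcases le_total z 0 with h | h
  · rw [F0 z h, Ioc_eq_empty (by simp [h])]; simp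
  rw [hint _ ⟨le_min hM.le h, min_le_left _ _⟩]
  rcases le_total (f c) z with h' | h'
  · rw [min_eq_left h', F1 z h']
  · rw [min_eq_right h']

/-- for a direction `θ` such that `f_θ` is continuous with a unique maximum,
the conditional CDF `z ↦ P(f_θ(S) ≤ z)` of `f_θ(S)` for `S` uniform on `[a,b]` (where `a`,`b`
are the minimal/maximal values of `⟨x,θ⟩` over `K`) is convex, continuous and strictly
increasing on `[0, m_K(θ)^{1/(n-1)}]`; in particular it is absolutely continuous. -/
theorem conditional_sectionCDF_convex {n : ℕ} (hn : 2 ≤ n)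
    (K : Set (Euc n)) (hK : IsConvexBody K) (θ : Euc n) (hθ : ‖θ‖ = 1)
    (a b : ℝ)
    (ha : IsLeast ((fun x => ⟪x, θ⟫) '' K) a) (hb : IsGreatest ((fun x => ⟪x, θ⟫) '' K) b)
    (hcont : Continuous (fun s => fTheta K θ s))
    (hmax : ∃! c : ℝ, ∀ s : ℝ, fTheta K θ s ≤ fTheta K θ c)
    (F : ℝ → ℝ)
    (hF : ∀ z : ℝ,
      F z = (volume (Set.Icc a b ∩ {s : ℝ | fTheta K θ s ≤ z})).toReal / (b - a)) :
    ConvexOn ℝ (Set.Icc 0 (innerSection K θ ^ ((1 : ℝ) / ((n : ℝ) - 1)))) F ∧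
    ContinuousOn F (Set.Icc 0 (innerSection K θ ^ ((1 : ℝ) / ((n : ℝ) - 1)))) ∧
    StrictMonoOn F (Set.Icc 0 (innerSection K θ ^ ((1 : ℝ) / ((n : ℝ) - 1)))) ∧
    IsAbsolutelyContinuousCDF F := by
  have hn' : (0:ℝ) < (n:ℝ) - 1 := by
    have : (2:ℝ) ≤ n := by exact_mod_cast hn
    linarith
  have hp : 0 < (1:ℝ) / ((n:ℝ) - 1) := by positivity
  have hconc := fTheta_concave hn K hK θ hθ a b ha hb
  obtain ⟨c, hc, hcu⟩ := hmax
  have sv0 : ∀ s, 0 ≤ sectionVolume K θ s := fun s => ENNReal.toReal_nonneg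
  have f0 : ∀ s, 0 ≤ fTheta K θ s := fun s => Real.rpow_nonneg (sv0 s) _
  have hlt : ∀ s, s ≠ c → fTheta K θ s < fTheta K θ c := by
    intro s hs
    refine lt_of_le_of_ne (hc s) fun h => hs (hcu s ?_)
    intro r
    rw [h]
    exact hc r
  have hM : 0 < fTheta K θ c := (f0 (c + 1)).trans_lt (hlt _ (by linarith))
  have hout : ∀ s, s ∉ Icc a b → fTheta K θ s = 0 := by
    intro s hs
    have : K ∩ hyperplane θ s = ∅ := by
      rw [eq_empty_iff_forall_notMem]
      rintro x ⟨hx, hxs⟩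
      have hxs' : ⟪x, θ⟫ = s := hxs
      exact hs ⟨ha.2 ⟨x, hx, hxs⟩, hb.2 ⟨x, hx, hxs⟩⟩
    simp only [fTheta, sectionVolume, this, measure_empty, ENNReal.toReal_zero]
    exact Real.zero_rpow hp.ne'
  have hclosed : IsClosed {s | fTheta K θ s = 0} := isClosed_eq hcont continuous_const
  have fa : fTheta K θ a = 0 := by
    have : closure (Iio a) ⊆ {s | fTheta K θ s = 0} :=
      hclosed.closure_subset_iff.2 fun s hs => hout s fun h => absurd h.1 (not_le.2 hs)
    exact this (by rw [closure_Iio]; exact self_mem_Iic)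
  have fb : fTheta K θ b = 0 := by
    have : closure (Ioi b) ⊆ {s | fTheta K θ s = 0} :=
      hclosed.closure_subset_iff.2 fun s hs => hout s fun h => absurd h.2 (not_le.2 hs)
    exact this (by rw [closure_Ioi]; exact self_mem_Ici)
  have hcm : c ∈ Icc a b := by
    by_contra h
    exact hM.ne' (hout c h)
  have hac : a < c := lt_of_le_of_ne hcm.1 (by rintro rfl; exact hM.ne' fa)
  have hcb : c < b := lt_of_le_of_ne hcm.2 (by rintro rfl; exact hM.ne' fb)
  have hsup : innerSection K θ = sectionVolume K θ c := by
    have hle : ∀ s, sectionVolume K θ s ≤ sectionVolume K θ c := fun s =>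
      (Real.rpow_le_rpow_iff (sv0 s) (sv0 c) hp).1 (hc s)
    exact le_antisymm (ciSup_le hle) (le_ciSup ⟨_, by rintro _ ⟨s, rfl⟩; exact hle s⟩ c)
  rw [hsup]
  exact abstract_cdf a b c (fTheta K θ) hac hcb hcont hconc hlt f0 fa F hF
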